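/- For all vectors s = (s₁,s₂,s₃), p = (p₁,p₂,p₃) in ℝ³ and every real 3×3 matrix β = (β_{ij}), let ρ = (1/4)I₄ + (1/2)Σᵢ sᵢ σᵢ⊗I₂ + (1/2)Σᵢ pᵢ I₂⊗σᵢ + Σ_{i,j} β_{ij} σᵢ⊗σⱼ. Then det(ρ^Γ) = 1/256 - (1/32)(4I₂ + I₄ + I₇) + (1/2)(4I₁ + I₁₂) + (1/16)(32I₃ - 16I₅ - 16I₈ - 16I₁₄ - 16I₂² + I₄² + I₇² + 8I₂I₄ + 8I₂I₇ - 2I₄I₇), where I₁ = det β, I₂ = tr(βᵀβ), I₃ = tr((βᵀβ)²), I₄ = |s|², I₅ = |βᵀs|², I₇ = |p|², I₈ = |βp|², I₁₂ = sᵀβp, and I₁₄ = Σ e_{ijk} e_{lmn} sᵢ p_l β_{jm} β_{kn} (sum over all indices 1..3, e the Levi-Civita symbol). -/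

import Mathlib

open Kronecker
open scoped Matrix
open Complex (I)

/-- The three Pauli matrices `σ₁, σ₂, σ₃`. -/
noncomputable def pauli : Fin 3 → Matrix (Fin 2) (Fin 2) ℂ :=
  ![!![0, 1; 1, 0], !![0, -I; I, 0], !![1, 0; 0, -1]]

/-- Partial transpose with respect to the second tensor factor:
`(ρ^Γ)_{(i,j),(k,l)} = ρ_{(i,l),(k,j)}`. -/
def partialTranspose (ρ : Matrix (Fin 2 × Fin 2) (Fin 2 × Fin 2) ℂ) :
    Matrix (Fin 2 × Fin 2) (Fin 2 × Fin 2) ℂ :=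
  fun p q => ρ (p.1, q.2) (q.1, p.2)

/-- The Levi-Civita symbol on `Fin 3` (as a real number). -/
noncomputable def levi (i j k : Fin 3) : ℝ :=
  (((j : ℝ) - (i : ℝ)) * ((k : ℝ) - (j : ℝ)) * ((k : ℝ) - (i : ℝ))) / 2

/-- Cofactor expansion of a `4 × 4` determinant. -/
theorem det_fin_four {R : Type*} [CommRing R] (M : Matrix (Fin 4) (Fin 4) R) :
    M.det =
      M 0 0 * (M 1 1 * (M 2 2 * M 3 3 - M 2 3 * M 3 2) - M 1 2 * (M 2 1 * M 3 3 - M 2 3 * M 3 1)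
        + M 1 3 * (M 2 1 * M 3 2 - M 2 2 * M 3 1))
      - M 0 1 * (M 1 0 * (M 2 2 * M 3 3 - M 2 3 * M 3 2) - M 1 2 * (M 2 0 * M 3 3 - M 2 3 * M 3 0)
        + M 1 3 * (M 2 0 * M 3 2 - M 2 2 * M 3 0))
      + M 0 2 * (M 1 0 * (M 2 1 * M 3 3 - M 2 3 * M 3 1) - M 1 1 * (M 2 0 * M 3 3 - M 2 3 * M 3 0)
        + M 1 3 * (M 2 0 * M 3 1 - M 2 1 * M 3 0))
      - M 0 3 * (M 1 0 * (M 2 1 * M 3 2 - M 2 2 * M 3 1) - M 1 1 * (M 2 0 * M 3 2 - M 2 2 * M 3 0)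
        + M 1 2 * (M 2 0 * M 3 1 - M 2 1 * M 3 0)) := by
  rw [Matrix.det_succ_row_zero]
  simp [Fin.sum_univ_succ, Matrix.det_fin_three, Fin.succAbove]
  ring

/-- Determinant of a `4 × 4` hermitian matrix in terms of the real and imaginary parts of its
entries. -/
theorem det_hermitian_fin_four (a b c d u u' v v' w w' x x' y y' z z' : ℝ) :
    (!![(a : ℂ), u + u' * I, v + v' * I, w + w' * I;
        u - u' * I, b, x + x' * I, y + y' * I;
        v - v' * I, x - x' * I, c, z + z' * I;
        w - w' * I, y - y' * I, z - z' * I, d]).det =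
      ((a * b * c * d - a * b * (z ^ 2 + z' ^ 2) - a * c * (y ^ 2 + y' ^ 2)
        - a * d * (x ^ 2 + x' ^ 2) - b * c * (w ^ 2 + w' ^ 2) - b * d * (v ^ 2 + v' ^ 2)
        - c * d * (u ^ 2 + u' ^ 2)
        + 2 * a * ((x * z - x' * z') * y + (x * z' + x' * z) * y')
        + 2 * b * ((v * z - v' * z') * w + (v * z' + v' * z) * w')
        + 2 * c * ((u * y - u' * y') * w + (u * y' + u' * y) * w')
        + 2 * d * ((u * x - u' * x') * v + (u * x' + u' * x) * v')
        + (u ^ 2 + u' ^ 2) * (z ^ 2 + z' ^ 2) + (v ^ 2 + v' ^ 2) * (y ^ 2 + y' ^ 2)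
        + (w ^ 2 + w' ^ 2) * (x ^ 2 + x' ^ 2)
        - 2 * ((u * y - u' * y') * (v * z - v' * z') + (u * y' + u' * y) * (v * z' + v' * z))
        - 2 * (((u * x - u' * x') * z - (u * x' + u' * x) * z') * w
          + ((u * x - u' * x') * z' + (u * x' + u' * x) * z) * w')
        - 2 * ((v * w + v' * w') * (x * y + x' * y')
          + (v * w' - v' * w) * (x * y' - x' * y)) : ℝ) : ℂ) := by
  rw [det_fin_four]
  apply Complex.ext <;>
  · simp [pow_two]
    ring

/-- The contraction defining `I₁₄`, in terms of the cofactors of `β`. -/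
theorem sum_levi_mul_levi (s p : Fin 3 → ℝ) (β : Matrix (Fin 3) (Fin 3) ℝ) :
    ∑ i, ∑ j, ∑ k, ∑ l, ∑ m, ∑ n, levi i j k * levi l m n * s i * p l * β j m * β k n =
      2 * ∑ i, ∑ l, s i * p l *
        (β (i + 1) (l + 1) * β (i + 2) (l + 2) - β (i + 1) (l + 2) * β (i + 2) (l + 1)) := by
  simp [Fin.sum_univ_three, levi]
  ring

/-- the expression of `det ρ^Γ` in terms of Makhlin's invariants
`I₁, I₂, I₃, I₄, I₅, I₇, I₈, I₁₂, I₁₄`, for the two-qubit state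
`ρ = (1/4)I₄ + (1/2)∑ sᵢ σᵢ⊗I₂ + (1/2)∑ pᵢ I₂⊗σᵢ + ∑ βᵢⱼ σᵢ⊗σⱼ`. -/
theorem det_partialTranspose_makhlin
    (s p : Fin 3 → ℝ) (β : Matrix (Fin 3) (Fin 3) ℝ)
    (ρ : Matrix (Fin 2 × Fin 2) (Fin 2 × Fin 2) ℂ)
    (hρ : ρ = (1 / 4 : ℂ) • (1 : Matrix (Fin 2 × Fin 2) (Fin 2 × Fin 2) ℂ)
        + (1 / 2 : ℂ) • ∑ i, (s i : ℂ) • (pauli i ⊗ₖ (1 : Matrix (Fin 2) (Fin 2) ℂ))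
        + (1 / 2 : ℂ) • ∑ i, (p i : ℂ) • ((1 : Matrix (Fin 2) (Fin 2) ℂ) ⊗ₖ pauli i)
        + ∑ i, ∑ j, (β i j : ℂ) • (pauli i ⊗ₖ pauli j))
    (I1 I2 I3 I4 I5 I7 I8 I12 I14 : ℝ)
    (hI1 : I1 = β.det)
    (hI2 : I2 = (βᵀ * β).trace)
    (hI3 : I3 = ((βᵀ * β) * (βᵀ * β)).trace)
    (hI4 : I4 = ∑ i, s i ^ 2)
    (hI5 : I5 = ∑ j, (∑ i, s i * β i j) ^ 2)
    (hI7 : I7 = ∑ i, p i ^ 2)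
    (hI8 : I8 = ∑ i, (∑ j, β i j * p j) ^ 2)
    (hI12 : I12 = ∑ i, ∑ j, s i * β i j * p j)
    (hI14 : I14 = ∑ i, ∑ j, ∑ k, ∑ l, ∑ m, ∑ n,
        levi i j k * levi l m n * s i * p l * β j m * β k n) :
    (partialTranspose ρ).det
      = ((1 / 256 - (1 / 32) * (4 * I2 + I4 + I7) + (1 / 2) * (4 * I1 + I12)
          + (1 / 16) * (32 * I3 - 16 * I5 - 16 * I8 - 16 * I14 - 16 * I2 ^ 2
              + I4 ^ 2 + I7 ^ 2 + 8 * I2 * I4 + 8 * I2 * I7 - 2 * I4 * I7) : ℝ) : ℂ) := by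
  have hρΓ : (partialTranspose ρ).submatrix finProdFinEquiv.symm finProdFinEquiv.symm =
      !![((1 / 4 + s 2 / 2 + p 2 / 2 + β 2 2 : ℝ) : ℂ),
          ((p 0 / 2 + β 2 0 : ℝ) : ℂ) + ((p 1 / 2 + β 2 1 : ℝ) : ℂ) * I,
          ((s 0 / 2 + β 0 2 : ℝ) : ℂ) + ((-s 1 / 2 - β 1 2 : ℝ) : ℂ) * I,
          ((β 0 0 + β 1 1 : ℝ) : ℂ) + ((β 0 1 - β 1 0 : ℝ) : ℂ) * I;
        ((p 0 / 2 + β 2 0 : ℝ) : ℂ) - ((p 1 / 2 + β 2 1 : ℝ) : ℂ) * I,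
          ((1 / 4 + s 2 / 2 - p 2 / 2 - β 2 2 : ℝ) : ℂ),
          ((β 0 0 - β 1 1 : ℝ) : ℂ) + ((-β 0 1 - β 1 0 : ℝ) : ℂ) * I,
          ((s 0 / 2 - β 0 2 : ℝ) : ℂ) + ((-s 1 / 2 + β 1 2 : ℝ) : ℂ) * I;
        ((s 0 / 2 + β 0 2 : ℝ) : ℂ) - ((-s 1 / 2 - β 1 2 : ℝ) : ℂ) * I,
          ((β 0 0 - β 1 1 : ℝ) : ℂ) - ((-β 0 1 - β 1 0 : ℝ) : ℂ) * I,
          ((1 / 4 - s 2 / 2 + p 2 / 2 - β 2 2 : ℝ) : ℂ),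
          ((p 0 / 2 - β 2 0 : ℝ) : ℂ) + ((p 1 / 2 - β 2 1 : ℝ) : ℂ) * I;
        ((β 0 0 + β 1 1 : ℝ) : ℂ) - ((β 0 1 - β 1 0 : ℝ) : ℂ) * I,
          ((s 0 / 2 - β 0 2 : ℝ) : ℂ) - ((-s 1 / 2 + β 1 2 : ℝ) : ℂ) * I,
          ((p 0 / 2 - β 2 0 : ℝ) : ℂ) - ((p 1 / 2 - β 2 1 : ℝ) : ℂ) * I,
          ((1 / 4 - s 2 / 2 - p 2 / 2 + β 2 2 : ℝ) : ℂ)] := by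
    subst hρ
    ext i j
    fin_cases i <;> fin_cases j <;>
    · simp [partialTranspose, pauli, Fin.sum_univ_three, finProdFinEquiv, Fin.divNat, Fin.modNat,
        Matrix.kroneckerMap_apply]
      ring
  rw [sum_levi_mul_levi] at hI14
  rw [← Matrix.det_submatrix_equiv_self finProdFinEquiv.symm, hρΓ]
  refine (det_hermitian_fin_four ..).trans (congrArg _ ?_)
  subst hI1 hI2 hI3 hI4 hI5 hI7 hI8 hI12 hI14
  simp only [Matrix.det_fin_three, Matrix.trace, Matrix.diag, Matrix.mul_apply,
    Matrix.transpose_apply, Fin.sum_univ_three, Fin.reduceAdd]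
  ring
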